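/- Let (M², ds²) be a smooth two-dimensional Riemannian manifold and z : U → ℝ a smooth function on a coordinate neighborhood with |∇z| < 1 (so that ds² − dz² is a Riemannian metric). If the metric ds² − dz² has identically zero Gaussian curvature on U, then there exists, in a possibly smaller neighborhood, a smooth local isometric embedding of (U, ds²) into ℝ³ of the form (x(u,v), y(u,v), z(u,v)). -/

import Mathlib

open Set

/-- Partial derivative in the `u`-direction. -/
noncomputable def pdu13 (f : ℝ × ℝ → ℝ) (p : ℝ × ℝ) : ℝ := fderiv ℝ f p (1, 0)

/-- Partial derivative in the `v`-direction. -/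
noncomputable def pdv13 (f : ℝ × ℝ → ℝ) (p : ℝ × ℝ) : ℝ := fderiv ℝ f p (0, 1)

/-- Gaussian curvature of the metric `E du² + 2F dudv + G dv²`, via the Brioschi
formula. -/
noncomputable def gaussCurv13 (E F G : ℝ × ℝ → ℝ) (p : ℝ × ℝ) : ℝ :=
  (Matrix.det
      !![-(1 / 2) * pdv13 (pdv13 E) p + pdu13 (pdv13 F) p - (1 / 2) * pdu13 (pdu13 G) p,
          (1 / 2) * pdu13 E p, pdu13 F p - (1 / 2) * pdv13 E p;
        pdv13 F p - (1 / 2) * pdu13 G p, E p, F p;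
        (1 / 2) * pdv13 G p, F p, G p]
    - Matrix.det
      !![0, (1 / 2) * pdv13 E p, (1 / 2) * pdu13 G p;
        (1 / 2) * pdv13 E p, E p, F p;
        (1 / 2) * pdu13 G p, F p, G p]) / (E p * G p - F p ^ 2) ^ 2

section

open scoped ContDiff

variable {U : Set (ℝ × ℝ)} {f g : ℝ × ℝ → ℝ} {p : ℝ × ℝ}

lemma pdu13_add (hf : DifferentiableAt ℝ f p) (hg : DifferentiableAt ℝ g p) :
    pdu13 (fun q => f q + g q) p = pdu13 f p + pdu13 g p := by
  simp [pdu13, fderiv_fun_add hf hg]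

lemma pdv13_add (hf : DifferentiableAt ℝ f p) (hg : DifferentiableAt ℝ g p) :
    pdv13 (fun q => f q + g q) p = pdv13 f p + pdv13 g p := by
  simp [pdv13, fderiv_fun_add hf hg]

lemma pdu13_sub (hf : DifferentiableAt ℝ f p) (hg : DifferentiableAt ℝ g p) :
    pdu13 (fun q => f q - g q) p = pdu13 f p - pdu13 g p := by
  simp [pdu13, fderiv_fun_sub hf hg]

lemma pdv13_sub (hf : DifferentiableAt ℝ f p) (hg : DifferentiableAt ℝ g p) :
    pdv13 (fun q => f q - g q) p = pdv13 f p - pdv13 g p := by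
  simp [pdv13, fderiv_fun_sub hf hg]

lemma pdu13_mul (hf : DifferentiableAt ℝ f p) (hg : DifferentiableAt ℝ g p) :
    pdu13 (fun q => f q * g q) p = f p * pdu13 g p + g p * pdu13 f p := by
  simp [pdu13, fderiv_fun_mul hf hg]

lemma pdv13_mul (hf : DifferentiableAt ℝ f p) (hg : DifferentiableAt ℝ g p) :
    pdv13 (fun q => f q * g q) p = f p * pdv13 g p + g p * pdv13 f p := by
  simp [pdv13, fderiv_fun_mul hf hg]

lemma pdu13_cos (hf : DifferentiableAt ℝ f p) :
    pdu13 (fun q => Real.cos (f q)) p = -(Real.sin (f p) * pdu13 f p) := by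
  simp [pdu13, hf.hasFDerivAt.cos.fderiv]

lemma pdv13_cos (hf : DifferentiableAt ℝ f p) :
    pdv13 (fun q => Real.cos (f q)) p = -(Real.sin (f p) * pdv13 f p) := by
  simp [pdv13, hf.hasFDerivAt.cos.fderiv]

lemma pdu13_sin (hf : DifferentiableAt ℝ f p) :
    pdu13 (fun q => Real.sin (f q)) p = Real.cos (f p) * pdu13 f p := by
  simp [pdu13, hf.hasFDerivAt.sin.fderiv]

lemma pdv13_sin (hf : DifferentiableAt ℝ f p) :
    pdv13 (fun q => Real.sin (f q)) p = Real.cos (f p) * pdv13 f p := by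
  simp [pdv13, hf.hasFDerivAt.sin.fderiv]

lemma pdu13_congr (hU : IsOpen U) (hp : p ∈ U) (h : EqOn f g U) : pdu13 f p = pdu13 g p := by
  simp [pdu13, (h.eventuallyEq_of_mem (hU.mem_nhds hp)).fderiv_eq]

lemma pdv13_congr (hU : IsOpen U) (hp : p ∈ U) (h : EqOn f g U) : pdv13 f p = pdv13 g p := by
  simp [pdv13, (h.eventuallyEq_of_mem (hU.mem_nhds hp)).fderiv_eq]

lemma ContDiffOn.pdu13 (hU : IsOpen U) (hf : ContDiffOn ℝ ∞ f U) :
    ContDiffOn ℝ ∞ (pdu13 f) U :=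
  ((contDiffOn_infty_iff_fderiv_of_isOpen hU).1 hf).2.clm_apply contDiffOn_const

lemma ContDiffOn.pdv13 (hU : IsOpen U) (hf : ContDiffOn ℝ ∞ f U) :
    ContDiffOn ℝ ∞ (pdv13 f) U :=
  ((contDiffOn_infty_iff_fderiv_of_isOpen hU).1 hf).2.clm_apply contDiffOn_const

lemma ContDiffOn.differentiableAt_of_isOpen (hU : IsOpen U) (hf : ContDiffOn ℝ ∞ f U)
    (hp : p ∈ U) : DifferentiableAt ℝ f p :=
  (hf.contDiffAt (hU.mem_nhds hp)).differentiableAt (by simp)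

lemma pdu13_pdv13_comm (hU : IsOpen U) (hf : ContDiffOn ℝ ∞ f U) (hp : p ∈ U) :
    pdu13 (pdv13 f) p = pdv13 (pdu13 f) p := by
  have hf' : DifferentiableAt ℝ (fderiv ℝ f) p :=
    (((contDiffOn_infty_iff_fderiv_of_isOpen hU).1 hf).2.contDiffAt
      (hU.mem_nhds hp)).differentiableAt (by simp)
  have hs : IsSymmSndFDerivAt ℝ f p :=
    (hf.contDiffAt (hU.mem_nhds hp)).isSymmSndFDerivAt
      (by simpa using WithTop.coe_le_coe.2 (le_top : (2 : ℕ∞) ≤ ⊤))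
  have h (v w : ℝ × ℝ) : fderiv ℝ (fun q => fderiv ℝ f q v) p w = fderiv ℝ (fderiv ℝ f) p w v := by
    rw [fderiv_clm_apply hf' (differentiableAt_const v)]
    simp
  calc pdu13 (pdv13 f) p = fderiv ℝ (fderiv ℝ f) p (1, 0) (0, 1) := h _ _
    _ = fderiv ℝ (fderiv ℝ f) p (0, 1) (1, 0) := hs _ _
    _ = pdv13 (pdu13 f) p := (h _ _).symm

lemma clm_apply_eq_fst_mul_add_snd_mul (φ : ℝ × ℝ →L[ℝ] ℝ) (w : ℝ × ℝ) :
    φ w = w.1 * φ (1, 0) + w.2 * φ (0, 1) := by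
  conv_lhs => rw [show w = w.1 • ((1, 0) : ℝ × ℝ) + w.2 • ((0, 1) : ℝ × ℝ) by ext <;> simp]
  simp only [map_add, map_smul, smul_eq_mul]

/-- Poincaré lemma for smooth `1`-forms `P du + Q dv` on convex open subsets of the plane. -/
lemma exists_pdu13_eq_pdv13_eq {P Q : ℝ × ℝ → ℝ} (hU : IsOpen U) (hc : Convex ℝ U)
    (hP : ContDiffOn ℝ ∞ P U) (hQ : ContDiffOn ℝ ∞ Q U)
    (h : ∀ p ∈ U, pdv13 P p = pdu13 Q p) :
    ∃ f : ℝ × ℝ → ℝ, ContDiffOn ℝ ∞ f U ∧ ∀ p ∈ U, pdu13 f p = P p ∧ pdv13 f p = Q p := by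
  set η : ℝ × ℝ → ℝ × ℝ →L[ℝ] ℝ := fun q =>
    P q • ContinuousLinearMap.fst ℝ ℝ ℝ + Q q • ContinuousLinearMap.snd ℝ ℝ ℝ with hη
  have hηc : ContDiffOn ℝ ∞ η U :=
    (hP.smul contDiffOn_const).add (hQ.smul contDiffOn_const)
  have hdη : ∀ a ∈ U, ∀ x y, fderiv ℝ η a x y = fderiv ℝ η a y x := by
    intro a ha x y
    have h1 := (hP.differentiableAt_of_isOpen hU ha).hasFDerivAt
    have h2 := (hQ.differentiableAt_of_isOpen hU ha).hasFDerivAt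
    have h3 := (h1.smul_const (ContinuousLinearMap.fst ℝ ℝ ℝ)).add
      (h2.smul_const (ContinuousLinearMap.snd ℝ ℝ ℝ))
    have h4 : fderiv ℝ η a = _ := h3.fderiv
    have h5 := h a ha
    simp only [pdu13, pdv13] at h5
    rw [h4]
    simp [clm_apply_eq_fst_mul_add_snd_mul (fderiv ℝ P a) x,
      clm_apply_eq_fst_mul_add_snd_mul (fderiv ℝ P a) y,
      clm_apply_eq_fst_mul_add_snd_mul (fderiv ℝ Q a) x,
      clm_apply_eq_fst_mul_add_snd_mul (fderiv ℝ Q a) y, h5]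
    ring
  obtain ⟨f, hf⟩ := hc.exists_forall_hasFDerivAt_of_fderiv_symmetric hU
    (hηc.differentiableOn (by simp)) hdη
  refine ⟨f, (contDiffOn_infty_iff_fderiv_of_isOpen hU).2
    ⟨fun a ha => (hf a ha).differentiableAt.differentiableWithinAt,
      hηc.congr fun a ha => (hf a ha).fderiv⟩, fun a ha => ?_⟩
  simp [pdu13, pdv13, (hf a ha).fderiv, hη]

/-- Cartan's second structure equation for the orthonormal coframe `a du + b dv`, `c dv` with
connection form `P du + Q dv`. -/
lemma gaussCurv13_of_coframe {a b c P Q E F G : ℝ × ℝ → ℝ} (hU : IsOpen U)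
    (ha : ContDiffOn ℝ ∞ a U) (hb : ContDiffOn ℝ ∞ b U) (hc : ContDiffOn ℝ ∞ c U)
    (hP : ContDiffOn ℝ ∞ P U) (hQ : ContDiffOn ℝ ∞ Q U)
    (ha0 : ∀ q ∈ U, a q ≠ 0) (hc0 : ∀ q ∈ U, c q ≠ 0)
    (hE : EqOn E (fun q => a q * a q) U) (hF : EqOn F (fun q => a q * b q) U)
    (hG : EqOn G (fun q => b q * b q + c q * c q) U)
    (hPc : EqOn (fun q => P q * c q) (fun q => pdu13 b q - pdv13 a q) U)
    (hQa : EqOn (fun q => Q q * a q) (fun q => pdu13 c q + P q * b q) U) (hp : p ∈ U) :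
    gaussCurv13 E F G p = (pdv13 P p - pdu13 Q p) / (a p * c p) := by
  have hd {f : ℝ × ℝ → ℝ} (hf : ContDiffOn ℝ ∞ f U) {q} (hq : q ∈ U) : DifferentiableAt ℝ f q :=
    hf.differentiableAt_of_isOpen hU hq
  have hav := ha.pdv13 hU
  have hbu := hb.pdu13 hU
  have hbv := hb.pdv13 hU
  have hcu := hc.pdu13 hU
  have hEu : EqOn (pdu13 E) (fun q => a q * pdu13 a q + a q * pdu13 a q) U := fun q hq => by
    rw [pdu13_congr hU hq hE, pdu13_mul (hd ha hq) (hd ha hq)]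
  have hEv : EqOn (pdv13 E) (fun q => a q * pdv13 a q + a q * pdv13 a q) U := fun q hq => by
    rw [pdv13_congr hU hq hE, pdv13_mul (hd ha hq) (hd ha hq)]
  have hFu : EqOn (pdu13 F) (fun q => a q * pdu13 b q + b q * pdu13 a q) U := fun q hq => by
    rw [pdu13_congr hU hq hF, pdu13_mul (hd ha hq) (hd hb hq)]
  have hFv : EqOn (pdv13 F) (fun q => a q * pdv13 b q + b q * pdv13 a q) U := fun q hq => by
    rw [pdv13_congr hU hq hF, pdv13_mul (hd ha hq) (hd hb hq)]
  have hGu : EqOn (pdu13 G) (fun q => (b q * pdu13 b q + b q * pdu13 b q) +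
      (c q * pdu13 c q + c q * pdu13 c q)) U := fun q hq => by
    rw [pdu13_congr hU hq hG, pdu13_add (hd (hb.mul hb) hq) (hd (hc.mul hc) hq),
      pdu13_mul (hd hb hq) (hd hb hq), pdu13_mul (hd hc hq) (hd hc hq)]
  have hGv : EqOn (pdv13 G) (fun q => (b q * pdv13 b q + b q * pdv13 b q) +
      (c q * pdv13 c q + c q * pdv13 c q)) U := fun q hq => by
    rw [pdv13_congr hU hq hG, pdv13_add (hd (hb.mul hb) hq) (hd (hc.mul hc) hq),
      pdv13_mul (hd hb hq) (hd hb hq), pdv13_mul (hd hc hq) (hd hc hq)]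
  have hEvv : pdv13 (pdv13 E) p = 2 * (a p * pdv13 (pdv13 a) p + pdv13 a p * pdv13 a p) := by
    have h := hd (ha.mul hav) hp
    rw [pdv13_congr hU hp hEv, pdv13_add h h, pdv13_mul (hd ha hp) (hd hav hp)]
    ring
  have hFvu : pdu13 (pdv13 F) p = a p * pdu13 (pdv13 b) p + pdv13 b p * pdu13 a p +
      (b p * pdu13 (pdv13 a) p + pdv13 a p * pdu13 b p) := by
    rw [pdu13_congr hU hp hFv, pdu13_add (hd (ha.mul hbv) hp) (hd (hb.mul hav) hp),
      pdu13_mul (hd ha hp) (hd hbv hp), pdu13_mul (hd hb hp) (hd hav hp)]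
  have hGuu : pdu13 (pdu13 G) p = 2 * (b p * pdu13 (pdu13 b) p + pdu13 b p * pdu13 b p) +
      2 * (c p * pdu13 (pdu13 c) p + pdu13 c p * pdu13 c p) := by
    have h := hd (hb.mul hbu) hp
    have h' := hd (hc.mul hcu) hp
    rw [pdu13_congr hU hp hGu, pdu13_add (h.fun_add h) (h'.fun_add h'), pdu13_add h h,
      pdu13_add h' h', pdu13_mul (hd hb hp) (hd hbu hp), pdu13_mul (hd hc hp) (hd hcu hp)]
    ring
  have hPu := pdu13_congr hU hp hPc
  rw [pdu13_mul (hd hP hp) (hd hc hp), pdu13_sub (hd hbu hp) (hd hav hp)] at hPu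
  have hPv := pdv13_congr hU hp hPc
  rw [pdv13_mul (hd hP hp) (hd hc hp), pdv13_sub (hd hbu hp) (hd hav hp),
    ← pdu13_pdv13_comm hU hb hp] at hPv
  have hQu := pdu13_congr hU hp hQa
  rw [pdu13_mul (hd hQ hp) (hd ha hp), pdu13_add (hd hcu hp) (hd (hP.mul hb) hp),
    pdu13_mul (hd hP hp) (hd hb hp)] at hQu
  have hPc' := hPc hp
  have hQa' := hQa hp
  have ha0 := ha0 p hp
  have hc0 := hc0 p hp
  unfold gaussCurv13
  rw [hEvv, hFvu, hGuu, hEu hp, hEv hp, hFu hp, hFv hp, hGu hp, hGv hp, hE hp, hF hp, hG hp]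
  simp only [Matrix.det_fin_three, Matrix.of_apply, Matrix.cons_val', Matrix.cons_val_zero,
    Matrix.cons_val_one, Matrix.cons_val]
  simp only at hPc' hQa' hPu hPv hQu
  generalize pdu13 P p = Pu at *
  generalize pdv13 P p = Pv at *
  generalize pdu13 Q p = Qu at *
  generalize P p = P0 at *
  generalize Q p = Q0 at *
  obtain rfl := eq_div_of_mul_eq hc0 hPc'
  obtain rfl := eq_div_of_mul_eq ha0 hQa'
  obtain rfl : Pu = (pdu13 (pdu13 b) p - pdu13 (pdv13 a) p -
      (pdu13 b p - pdv13 a p) / c p * pdu13 c p) / c p := by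
    rw [eq_div_iff hc0]; linear_combination hPu
  obtain rfl : Pv = (pdu13 (pdv13 b) p - pdv13 (pdv13 a) p -
      (pdu13 b p - pdv13 a p) / c p * pdv13 c p) / c p := by
    rw [eq_div_iff hc0]; linear_combination hPv
  rw [show Qu = (_ - _) / a p from
    eq_div_of_mul_eq ha0 ((mul_comm _ _).trans (eq_sub_of_add_eq' hQu))]
  field_simp
  ring

/-- A plane map with nonvanishing Jacobian is locally injective. -/
lemma exists_isOpen_injOn_of_jacobian_ne_zero (hU : IsOpen U) (hf : ContDiffOn ℝ ∞ f U)
    (hg : ContDiffOn ℝ ∞ g U) (hp : p ∈ U)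
    (hJ : pdu13 f p * pdv13 g p - pdv13 f p * pdu13 g p ≠ 0) :
    ∃ V : Set (ℝ × ℝ), IsOpen V ∧ p ∈ V ∧ InjOn (fun q => (f q, g q)) V := by
  have hs : HasStrictFDerivAt (fun q => (f q, g q)) ((fderiv ℝ f p).prod (fderiv ℝ g p)) p :=
    ((hf.contDiffAt (hU.mem_nhds hp)).hasStrictFDerivAt (by simp)).prodMk
      ((hg.contDiffAt (hU.mem_nhds hp)).hasStrictFDerivAt (by simp))
  set L := (fderiv ℝ f p).prod (fderiv ℝ g p) with hL
  have hinj : Function.Injective (L : ℝ × ℝ →ₗ[ℝ] ℝ × ℝ) := by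
    rw [injective_iff_map_eq_zero]
    rintro ⟨s, t⟩ hst
    have hst' : fderiv ℝ f p (s, t) = 0 ∧ fderiv ℝ g p (s, t) = 0 := by simpa [hL] using hst
    rw [clm_apply_eq_fst_mul_add_snd_mul (fderiv ℝ f p) (s, t),
      clm_apply_eq_fst_mul_add_snd_mul (fderiv ℝ g p) (s, t)] at hst'
    obtain ⟨h1, h2⟩ := hst'
    simp only [pdu13, pdv13] at hJ
    have hs0 : s = 0 := by
      refine (mul_eq_zero.1 ?_).resolve_right hJ
      linear_combination fderiv ℝ g p (0, 1) * h1 - fderiv ℝ f p (0, 1) * h2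
    have ht0 : t = 0 := by
      refine (mul_eq_zero.1 ?_).resolve_right hJ
      linear_combination fderiv ℝ f p (1, 0) * h2 - fderiv ℝ g p (1, 0) * h1
    simp [hs0, ht0]
  let e : (ℝ × ℝ) ≃L[ℝ] ℝ × ℝ :=
    (LinearEquiv.ofInjectiveEndo (L : ℝ × ℝ →ₗ[ℝ] ℝ × ℝ) hinj).toContinuousLinearEquiv
  have he : (e : ℝ × ℝ →L[ℝ] ℝ × ℝ) = L := by
    ext <;> rfl
  rw [← he] at hs
  exact ⟨_, (hs.toOpenPartialHomeomorph _).open_source,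
    hs.mem_toOpenPartialHomeomorph_source, (hs.toOpenPartialHomeomorph _).injOn⟩

/-- A flat Riemannian metric `E du² + 2F du dv + G dv²` is locally isometric to the plane. -/
lemma exists_flat_coordinates {E F G : ℝ × ℝ → ℝ} (hU : IsOpen U) (hp : p ∈ U)
    (hE : ContDiffOn ℝ ∞ E U) (hF : ContDiffOn ℝ ∞ F U) (hG : ContDiffOn ℝ ∞ G U)
    (hpos : ∀ q ∈ U, 0 < E q ∧ 0 < E q * G q - F q ^ 2)
    (hflat : ∀ q ∈ U, gaussCurv13 E F G q = 0) :
    ∃ V ⊆ U, IsOpen V ∧ p ∈ V ∧ ∃ x y : ℝ × ℝ → ℝ,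
      ContDiffOn ℝ ∞ x V ∧ ContDiffOn ℝ ∞ y V ∧ InjOn (fun q => (x q, y q)) V ∧
      ∀ q ∈ V, pdu13 x q ^ 2 + pdu13 y q ^ 2 = E q ∧
        pdu13 x q * pdv13 x q + pdu13 y q * pdv13 y q = F q ∧
        pdv13 x q ^ 2 + pdv13 y q ^ 2 = G q := by
  obtain ⟨r, hr, hball⟩ := Metric.isOpen_iff.1 hU p hp
  set B := Metric.ball p r
  have hB : IsOpen B := Metric.isOpen_ball
  have hBc : Convex ℝ B := convex_ball p r
  have hpB : p ∈ B := Metric.mem_ball_self hr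
  replace hE := hE.mono hball
  replace hF := hF.mono hball
  replace hG := hG.mono hball
  have hd {f : ℝ × ℝ → ℝ} (hf : ContDiffOn ℝ ∞ f B) {q} (hq : q ∈ B) : DifferentiableAt ℝ f q :=
    hf.differentiableAt_of_isOpen hB hq
  set a : ℝ × ℝ → ℝ := fun q => √(E q)
  have ha0 : ∀ q ∈ B, 0 < a q := fun q hq => Real.sqrt_pos.2 (hpos q (hball hq)).1
  have ha2 : ∀ q ∈ B, a q * a q = E q := fun q hq => Real.mul_self_sqrt (hpos q (hball hq)).1.le
  have ha : ContDiffOn ℝ ∞ a B := hE.sqrt fun q hq => (hpos q (hball hq)).1.ne'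
  set b : ℝ × ℝ → ℝ := fun q => F q / a q
  have hb : ContDiffOn ℝ ∞ b B := hF.div ha fun q hq => (ha0 q hq).ne'
  have hab : ∀ q ∈ B, a q * b q = F q := fun q hq => mul_div_cancel₀ _ (ha0 q hq).ne'
  set c : ℝ × ℝ → ℝ := fun q => √(E q * G q - F q ^ 2) / a q
  have hW : ContDiffOn ℝ ∞ (fun q => √(E q * G q - F q ^ 2)) B :=
    ((hE.mul hG).sub (hF.pow 2)).sqrt fun q hq => (hpos q (hball hq)).2.ne'
  have hc : ContDiffOn ℝ ∞ c B := hW.div ha fun q hq => (ha0 q hq).ne'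
  have hc0 : ∀ q ∈ B, 0 < c q := fun q hq =>
    div_pos (Real.sqrt_pos.2 (hpos q (hball hq)).2) (ha0 q hq)
  have hbc : ∀ q ∈ B, b q * b q + c q * c q = G q := fun q hq => by
    have h1 : a q * c q = √(E q * G q - F q ^ 2) := mul_div_cancel₀ _ (ha0 q hq).ne'
    have h2 := Real.mul_self_sqrt (hpos q (hball hq)).2.le
    rw [← h1, ← ha2 q hq, ← hab q hq] at h2
    have h3 := (mul_pos (ha0 q hq) (ha0 q hq)).ne'
    apply mul_left_cancel₀ h3
    linear_combination h2
  set P : ℝ × ℝ → ℝ := fun q => (pdu13 b q - pdv13 a q) / c q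
  have hP : ContDiffOn ℝ ∞ P B :=
    ((hb.pdu13 hB).sub (ha.pdv13 hB)).div hc fun q hq => (hc0 q hq).ne'
  have hPc : ∀ q ∈ B, P q * c q = pdu13 b q - pdv13 a q := fun q hq =>
    div_mul_cancel₀ _ (hc0 q hq).ne'
  set Q : ℝ × ℝ → ℝ := fun q => (pdu13 c q + P q * b q) / a q
  have hQ : ContDiffOn ℝ ∞ Q B :=
    ((hc.pdu13 hB).add (hP.mul hb)).div ha fun q hq => (ha0 q hq).ne'
  have hQa : ∀ q ∈ B, Q q * a q = pdu13 c q + P q * b q := fun q hq =>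
    div_mul_cancel₀ _ (ha0 q hq).ne'
  have hPQ : ∀ q ∈ B, pdv13 P q = pdu13 Q q := fun q hq => by
    have h := gaussCurv13_of_coframe hB ha hb hc hP hQ (fun q hq => (ha0 q hq).ne')
      (fun q hq => (hc0 q hq).ne') (fun q hq => (ha2 q hq).symm) (fun q hq => (hab q hq).symm)
      (fun q hq => (hbc q hq).symm) hPc hQa hq
    rw [hflat q (hball hq), eq_comm,
      div_eq_zero_iff, or_iff_left (mul_pos (ha0 q hq) (hc0 q hq)).ne'] at h
    exact sub_eq_zero.1 h
  obtain ⟨φ, hφ, hφd⟩ := exists_pdu13_eq_pdv13_eq hB hBc hP hQ hPQ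
  have hcos : ContDiffOn ℝ ∞ (fun q => Real.cos (φ q)) B := hφ.cos
  have hsin : ContDiffOn ℝ ∞ (fun q => Real.sin (φ q)) B := hφ.sin
  obtain ⟨x, hx, hxd⟩ := exists_pdu13_eq_pdv13_eq hB hBc (hcos.mul ha)
    ((hcos.mul hb).sub (hsin.mul hc)) fun q hq => by
      rw [pdv13_mul (hd hcos hq) (hd ha hq),
        pdu13_sub (hd (hcos.mul hb) hq) (hd (hsin.mul hc) hq),
        pdu13_mul (hd hcos hq) (hd hb hq), pdu13_mul (hd hsin hq) (hd hc hq),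
        pdv13_cos (hd hφ hq), pdu13_cos (hd hφ hq), pdu13_sin (hd hφ hq), (hφd q hq).1,
        (hφd q hq).2]
      linear_combination Real.cos (φ q) * hPc q hq - Real.sin (φ q) * hQa q hq
  obtain ⟨y, hy, hyd⟩ := exists_pdu13_eq_pdv13_eq hB hBc (hsin.mul ha)
    ((hsin.mul hb).add (hcos.mul hc)) fun q hq => by
      rw [pdv13_mul (hd hsin hq) (hd ha hq),
        pdu13_add (hd (hsin.mul hb) hq) (hd (hcos.mul hc) hq),
        pdu13_mul (hd hsin hq) (hd hb hq), pdu13_mul (hd hcos hq) (hd hc hq),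
        pdv13_sin (hd hφ hq), pdu13_sin (hd hφ hq), pdu13_cos (hd hφ hq), (hφd q hq).1,
        (hφd q hq).2]
      linear_combination Real.sin (φ q) * hPc q hq + Real.cos (φ q) * hQa q hq
  have hJ : pdu13 x p * pdv13 y p - pdv13 x p * pdu13 y p ≠ 0 := by
    rw [(hxd p hpB).1, (hxd p hpB).2, (hyd p hpB).1, (hyd p hpB).2]
    refine ne_of_eq_of_ne ?_ (mul_pos (ha0 p hpB) (hc0 p hpB)).ne'
    linear_combination a p * c p * Real.sin_sq_add_cos_sq (φ p)
  obtain ⟨V, hV, hpV, hinj⟩ := exists_isOpen_injOn_of_jacobian_ne_zero hB hx hy hpB hJ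
  refine ⟨B ∩ V, inter_subset_left.trans hball, hB.inter hV, ⟨hpB, hpV⟩, x, y,
    hx.mono inter_subset_left, hy.mono inter_subset_left, hinj.mono inter_subset_right,
    fun q ⟨hq, _⟩ => ?_⟩
  have h1 := Real.sin_sq_add_cos_sq (φ q)
  rw [(hxd q hq).1, (hxd q hq).2, (hyd q hq).1, (hyd q hq).2, ← ha2 q hq, ← hab q hq, ← hbc q hq]
  refine ⟨?_, ?_, ?_⟩
  · linear_combination a q * a q * h1
  · linear_combination a q * b q * h1
  · linear_combination (b q * b q + c q * c q) * h1

end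

/-- If `z` is smooth with `|∇z| < 1` (so `ds² - dz²` is a Riemannian metric) and the
metric `ds² - dz²` is flat on `U`, then in a possibly smaller neighborhood there is a
smooth local isometric embedding `(x, y, z)` of `(U, ds²)` into `ℝ³`. -/
theorem stmt_13 (U : Set (ℝ × ℝ)) (hU : IsOpen U) (p₀ : ℝ × ℝ) (hp₀ : p₀ ∈ U)
    (g11 g12 g22 : ℝ × ℝ → ℝ)
    (hg11 : ContDiffOn ℝ (⊤ : ℕ∞) g11 U) (hg12 : ContDiffOn ℝ (⊤ : ℕ∞) g12 U)
    (hg22 : ContDiffOn ℝ (⊤ : ℕ∞) g22 U)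
    (hpos : ∀ p ∈ U, 0 < g11 p ∧ 0 < g11 p * g22 p - g12 p ^ 2)
    (z : ℝ × ℝ → ℝ) (hz : ContDiffOn ℝ (⊤ : ℕ∞) z U)
    (hgrad : ∀ p ∈ U, 0 < g11 p - (pdu13 z p) ^ 2 ∧
      0 < (g11 p - (pdu13 z p) ^ 2) * (g22 p - (pdv13 z p) ^ 2) -
        (g12 p - pdu13 z p * pdv13 z p) ^ 2)
    (hflat : ∀ p ∈ U,
      gaussCurv13 (fun q => g11 q - (pdu13 z q) ^ 2)
        (fun q => g12 q - pdu13 z q * pdv13 z q)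
        (fun q => g22 q - (pdv13 z q) ^ 2) p = 0) :
    ∃ V ⊆ U, IsOpen V ∧ p₀ ∈ V ∧ ∃ x y : ℝ × ℝ → ℝ,
      ContDiffOn ℝ (⊤ : ℕ∞) x V ∧ ContDiffOn ℝ (⊤ : ℕ∞) y V ∧
      InjOn (fun p => (x p, y p, z p)) V ∧
      ∀ p ∈ V,
        (pdu13 x p) ^ 2 + (pdu13 y p) ^ 2 + (pdu13 z p) ^ 2 = g11 p ∧
        pdu13 x p * pdv13 x p + pdu13 y p * pdv13 y p + pdu13 z p * pdv13 z p = g12 p ∧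
        (pdv13 x p) ^ 2 + (pdv13 y p) ^ 2 + (pdv13 z p) ^ 2 = g22 p := by
  have hzu := hz.pdu13 hU
  have hzv := hz.pdv13 hU
  obtain ⟨V, hVU, hV, hpV, x, y, hx, hy, hinj, h⟩ := exists_flat_coordinates hU hp₀
    (hg11.sub (hzu.pow 2)) (hg12.sub (hzu.mul hzv)) (hg22.sub (hzv.pow 2)) hgrad hflat
  refine ⟨V, hVU, hV, hpV, x, y, hx, hy, fun q hq q' hq' hqq => hinj hq hq' ?_, fun q hq => ?_⟩
  · simp only [Prod.mk.injEq] at hqq ⊢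
    exact ⟨hqq.1, hqq.2.1⟩
  · obtain ⟨h1, h2, h3⟩ := h q hq
    exact ⟨by linear_combination h1, by linear_combination h2, by linear_combination h3⟩
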